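/- Let π be a permutation of {1,…,n} whose disjoint cycle decomposition has maximum cycle length ℓ > 1, and let P_π be the associated permutation matrix. For t ≥ 0, let Φ_{t,π} : M_n(ℂ) → M_n(ℂ) be the D-type map with D = (n−t)I_n + tP_π, i.e., Φ_{t,π}(A) = diag(f_1,…,f_n) − A where f_j = ∑_k a_{kk} d_{kj}. Then Φ_{t,π} is positive if and only if t ≤ n/ℓ. -/

import Mathlib

lemma amgm_aux {ι : Type*} (E : Finset ι) (y : ι → ℝ) (hy : ∀ i ∈ E, 0 < y i) (hE : 0 < E.card) :
    (E.card : ℝ) * ∏ i ∈ E, y i ≤ ∑ i ∈ E, y i ^ E.card := by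
  have h := Real.geom_mean_le_arith_mean E (fun _ => 1) (fun i => y i ^ E.card) (by simp)
    (by simpa using hE) (fun i hi => (pow_pos (hy i hi) _).le)
  simp only [Real.rpow_one, Finset.sum_const, nsmul_eq_mul, mul_one, one_mul] at h
  rw [Finset.prod_pow, Real.pow_rpow_inv_natCast (Finset.prod_nonneg fun i hi => (hy i hi).le) hE.ne',
    le_div_iff₀ (by exact_mod_cast hE)] at h
  linarith

lemma cyc_aux {ι : Type*} [DecidableEq ι] (C : Finset ι) (y : ι → ℝ) (hy : ∀ i ∈ C, 0 < y i)
    (m : ℕ) (hm : 0 < m) (hC : C.card = m + 1) (hp : ∏ i ∈ C, y i = 1) :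
    ∑ i ∈ C, 1 / ((m : ℝ) + y i ^ (m + 1)) ≤ 1 := by
  set W := ∑ i ∈ C, y i ^ m with hW
  have hne : C.Nonempty := Finset.card_pos.1 (by omega)
  have hWpos : 0 < W := Finset.sum_pos (fun i hi => pow_pos (hy i hi) _) hne
  have hm' : (0 : ℝ) < m := by exact_mod_cast hm
  have key : ∀ i ∈ C, 1 / ((m : ℝ) + y i ^ (m + 1)) ≤ (1 - y i ^ m / W) / m := by
    intro i hi
    have hyi := hy i hi
    have hc : (C.erase i).card = m := by rw [Finset.card_erase_of_mem hi]; omega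
    have h := amgm_aux (C.erase i) y (fun j hj => hy j (Finset.mem_of_mem_erase hj)) (by omega)
    rw [hc] at h
    have e1 : y i * ∏ j ∈ C.erase i, y j = 1 := by rw [Finset.mul_prod_erase _ _ hi, hp]
    have e2 : y i ^ m + ∑ j ∈ C.erase i, y j ^ m = W := by
      rw [Finset.add_sum_erase C (fun j => y j ^ m) hi]
    have h3 : (m : ℝ) ≤ y i * (W - y i ^ m) := by
      have := mul_le_mul_of_nonneg_left h hyi.le
      have e3 : y i * ((m : ℝ) * ∏ j ∈ C.erase i, y j) = m := by
        rw [mul_left_comm, e1, mul_one]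
      rw [← e2]
      linarith
    have hpow : 0 < y i ^ m := pow_pos hyi m
    rw [one_sub_div hWpos.ne', div_div, div_le_div_iff₀ (by positivity) (by positivity), pow_succ]
    nlinarith
  refine (Finset.sum_le_sum key).trans ?_
  rw [← Finset.sum_div, Finset.sum_sub_distrib, ← Finset.sum_div, ← hW, div_self hWpos.ne']
  simp [hC, hm'.ne']

lemma cyc_ineq {ι : Type*} [DecidableEq ι] (C : Finset ι) (hne : C.Nonempty) (r : ι → ℝ)
    (hr : ∀ i ∈ C, 0 < r i) (hp : ∏ i ∈ C, r i = 1) (s : ℝ) (hs : 0 ≤ s) (hs1 : s * C.card ≤ 1) :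
    ∑ i ∈ C, 1 / (1 - s + s * r i) ≤ C.card := by
  have hcp := Finset.card_pos.2 hne
  rcases Nat.lt_or_ge 1 C.card with hc | hc
  swap
  · obtain ⟨a, rfl⟩ := Finset.card_eq_one.1 (le_antisymm hc hcp)
    simp at hp
    simp [hp]
  obtain ⟨m, hm⟩ : ∃ m, C.card = m + 1 := ⟨C.card - 1, by omega⟩
  have hm0 : 0 < m := by omega
  have hm' : (0 : ℝ) < m := by exact_mod_cast hm0
  have h := cyc_aux C (fun i => r i ^ (((m + 1 : ℕ) : ℝ)⁻¹)) (fun i hi => Real.rpow_pos_of_pos (hr i hi) _)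
    m hm0 hm (by rw [Real.finsetProd_rpow _ _ (fun i hi => (hr i hi).le), hp, Real.one_rpow])
  have h' : ∑ i ∈ C, 1 / ((m : ℝ) + r i) ≤ 1 := by
    refine le_trans (le_of_eq (Finset.sum_congr rfl fun i hi => ?_)) h
    rw [Real.rpow_inv_natCast_pow (hr i hi).le (by omega)]
  rw [hm] at hs1 ⊢
  push_cast at hs1 ⊢
  have key : ∀ i ∈ C, 1 / (1 - s + s * r i) ≤
      (1 - s * (m + 1)) + s * (m + 1) * (m + 1) * (1 / (m + r i)) := by
    intro i hi
    have hri := hr i hi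
    have hs2 : s < 1 := by nlinarith
    have hd : 0 < 1 - s + s * r i := by nlinarith [mul_nonneg hs hri.le]
    have hd2 : 0 < (m : ℝ) + r i := by positivity
    have : (1 - s * (m + 1)) + s * (m + 1) * (m + 1) * (1 / (m + r i)) - 1 / (1 - s + s * r i)
      = s * (1 - s * (m + 1)) * (r i - 1)^2 / ((m + r i) * (1 - s + s * r i)) := by
      field_simp
      ring
    have h0 : 0 ≤ s * (1 - s * (m + 1)) * (r i - 1)^2 / ((m + r i) * (1 - s + s * r i)) := by
      have : 0 ≤ 1 - s * (m + 1) := by linarith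
      positivity
    linarith
  refine (Finset.sum_le_sum key).trans ?_
  rw [Finset.sum_add_distrib, ← Finset.mul_sum]
  simp only [Finset.sum_const, hm, nsmul_eq_mul]
  push_cast
  have : 0 ≤ s * (m + 1) * (m + 1) := by positivity
  nlinarith

lemma perm_card {n : ℕ} (π : Equiv.Perm (Fin n)) (ℓ : ℕ)
    (hℓ : (Equiv.Perm.cycleType π).sup = ℓ) (hℓ1 : 1 < ℓ) (x : Fin n) :
    (Finset.univ.filter (fun y => π.SameCycle x y)).card ≤ ℓ := by
  by_cases hx : π x = x
  · have : (Finset.univ.filter (fun y => π.SameCycle x y)) ⊆ {x} := by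
      intro y hy
      simp only [Finset.mem_filter, Finset.mem_univ, true_and] at hy
      have := hy.eq_of_left hx
      simp [this]
    have := Finset.card_le_card this
    simp at this
    omega
  · have : (Finset.univ.filter (fun y => π.SameCycle x y)) = (π.cycleOf x).support := by
      ext y
      rw [Equiv.Perm.mem_support_cycleOf_iff' hx]
      simp
    rw [this, ← hℓ]
    apply Multiset.le_sup
    rw [Equiv.Perm.cycleType_def]
    refine Multiset.mem_map.2 ⟨π.cycleOf x, ?_, rfl⟩
    exact Equiv.Perm.cycleOf_mem_cycleFactorsFinset_iff.2 (Equiv.Perm.mem_support.2 hx)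

lemma sup_mem_aux (s : Multiset ℕ) (h : 0 < s.sup) : s.sup ∈ s := by
  induction s using Multiset.induction_on with
  | empty => simp at h
  | cons a s ih =>
    rw [Multiset.sup_cons] at h ⊢
    rcases le_total a s.sup with h1 | h1
    · rw [sup_eq_right.2 h1] at h ⊢
      exact Multiset.mem_cons_of_mem (ih h)
    · rw [sup_eq_left.2 h1]
      exact Multiset.mem_cons_self _ _

lemma perm_exists {n : ℕ} (π : Equiv.Perm (Fin n)) (ℓ : ℕ)
    (hℓ : (Equiv.Perm.cycleType π).sup = ℓ) (hℓ1 : 1 < ℓ) :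
    ∃ x, π x ≠ x ∧ (Finset.univ.filter (fun y => π.SameCycle x y)).card = ℓ := by
  have h := sup_mem_aux π.cycleType (by omega)
  rw [hℓ, Equiv.Perm.cycleType_def] at h
  obtain ⟨c, hc, hcl⟩ := Multiset.mem_map.1 h
  have hc : c ∈ π.cycleFactorsFinset := hc
  have hcy := (Equiv.Perm.mem_cycleFactorsFinset_iff.1 hc).1
  obtain ⟨x, hx⟩ := hcy.nonempty_support
  have hcx : c = π.cycleOf x := Equiv.Perm.cycle_is_cycleOf hx hc
  have hx' : π x ≠ x := Equiv.Perm.mem_support.1 (Equiv.Perm.mem_cycleFactorsFinset_support_le hc hx)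
  refine ⟨x, hx', ?_⟩
  rw [← hcl, Function.comp, hcx]
  congr 1
  ext y
  rw [Equiv.Perm.mem_support_cycleOf_iff' hx']
  simp

lemma sum_ineq {n : ℕ} (π : Equiv.Perm (Fin n)) (ℓ : ℕ)
    (hℓ : (Equiv.Perm.cycleType π).sup = ℓ) (hℓ1 : 1 < ℓ) (s : ℝ) (hs : 0 ≤ s) (hs1 : s * ℓ ≤ 1)
    (x : Fin n → ℝ) (hx : ∀ i, 0 < x i) :
    ∑ i, 1 / (1 - s + s * (x (π i) / x i)) ≤ n := by
  classical
  have e : (n : ℝ) = ∑ i : Fin n, (1 : ℝ) := by simp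
  rw [e, Finset.sum_partition (Equiv.Perm.SameCycle.setoid π),
    Finset.sum_partition (Equiv.Perm.SameCycle.setoid π)]
  refine Finset.sum_le_sum fun c hc => ?_
  obtain ⟨j, -, rfl⟩ := Finset.mem_image.1 hc
  have hset : (Finset.univ.filter fun y => (Quotient.mk (Equiv.Perm.SameCycle.setoid π) y)
      = Quotient.mk _ j) = Finset.univ.filter (fun y => π.SameCycle j y) := by
    ext y
    simp only [Finset.mem_filter, Finset.mem_univ, true_and, Quotient.eq]
    exact Equiv.Perm.sameCycle_comm
  rw [hset]
  have hcard := perm_card π ℓ hℓ hℓ1 j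
  simp only [Finset.sum_const, nsmul_eq_mul, mul_one]
  apply cyc_ineq
  · exact ⟨j, by simp [Equiv.Perm.SameCycle.refl]⟩
  · intro i _
    exact div_pos (hx _) (hx _)
  · rw [Finset.prod_div_distrib, div_eq_one_iff_eq (Finset.prod_pos fun i _ => hx i).ne']
    refine Finset.prod_equiv π ?_ ?_ <;> simp
  · exact hs
  · refine le_trans (mul_le_mul_of_nonneg_left ?_ hs) hs1
    exact_mod_cast hcard

/-- the real inequality, positive weights -/
lemma real_ineq_pos {n : ℕ} (π : Equiv.Perm (Fin n)) (ℓ : ℕ)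
    (hℓ : (Equiv.Perm.cycleType π).sup = ℓ) (hℓ1 : 1 < ℓ) (t : ℝ) (ht : 0 ≤ t)
    (hn : 0 < n) (h : t * ℓ ≤ n)
    (x v : Fin n → ℝ) (hx : ∀ i, 0 < x i) :
    (∑ i, v i * x i) ^ 2 ≤ ∑ i, ((n - t) * x i ^ 2 + t * x (π i) ^ 2) * v i ^ 2 := by
  have hn' : (0 : ℝ) < n := by exact_mod_cast hn
  have hl : (1 : ℝ) < ℓ := by exact_mod_cast hℓ1
  have htn : 0 < n - t := by
    rcases ht.eq_or_lt with h0 | h0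
    · rw [← h0]; simpa using hn'
    · nlinarith
  set f : Fin n → ℝ := fun i => (n - t) * x i ^ 2 + t * x (π i) ^ 2 with hf
  have hfpos : ∀ i, 0 < f i := fun i => by
    have := pow_pos (hx i) 2
    have := mul_pos htn this
    have : 0 ≤ t * x (π i) ^ 2 := by positivity
    simp only [hf]; linarith
  have hS := sum_ineq π ℓ hℓ hℓ1 (t / n) (by positivity) (by
    rw [div_mul_eq_mul_div, div_le_one hn']; exact h) (fun i => x i ^ 2) (fun i => pow_pos (hx i) 2)
  have hS' : ∑ i, x i ^ 2 / f i ≤ 1 := by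
    have : ∑ i, x i ^ 2 / f i = (∑ i, 1 / (1 - t / n + t / n * (x (π i) ^ 2 / x i ^ 2))) / n := by
      rw [Finset.sum_div]
      refine Finset.sum_congr rfl fun i _ => ?_
      have h1 := hx i
      have h2 := hfpos i
      have : 1 - t / n + t / n * (x (π i) ^ 2 / x i ^ 2) = f i / (n * x i ^ 2) := by
        simp only [hf]
        field_simp
      rw [this]
      field_simp
    rw [this, div_le_one hn']
    exact hS
  have hCS := Finset.sum_sq_le_sum_mul_sum_of_sq_le_mul Finset.univ (r := fun i => v i * x i)
    (f := fun i => f i * v i ^ 2) (g := fun i => x i ^ 2 / f i)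
    (fun i _ => mul_nonneg (hfpos i).le (sq_nonneg _))
    (fun i _ => div_nonneg (sq_nonneg _) (hfpos i).le)
    (fun i _ => by
      have := hfpos i
      apply le_of_eq
      field_simp)
  have h0 : 0 ≤ ∑ i, f i * v i ^ 2 := Finset.sum_nonneg fun i _ => mul_nonneg (hfpos i).le (sq_nonneg _)
  calc _ ≤ _ := hCS
    _ ≤ (∑ i, f i * v i ^ 2) * 1 := mul_le_mul_of_nonneg_left hS' h0
    _ = _ := by simp [hf]

lemma real_ineq {n : ℕ} (π : Equiv.Perm (Fin n)) (ℓ : ℕ)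
    (hℓ : (Equiv.Perm.cycleType π).sup = ℓ) (hℓ1 : 1 < ℓ) (t : ℝ) (ht : 0 ≤ t)
    (hn : 0 < n) (h : t * ℓ ≤ n)
    (x v : Fin n → ℝ) (hx : ∀ i, 0 ≤ x i) :
    (∑ i, v i * x i) ^ 2 ≤ ∑ i, ((n - t) * x i ^ 2 + t * x (π i) ^ 2) * v i ^ 2 := by
  have c1 : Continuous fun e : ℝ => (∑ i, v i * (x i + e)) ^ 2 := by fun_prop
  have c2 : Continuous fun e : ℝ =>
    ∑ i, ((n - t) * (x i + e) ^ 2 + t * (x (π i) + e) ^ 2) * v i ^ 2 := by fun_prop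
  have t1 := (c1.tendsto 0).mono_left (nhdsWithin_le_nhds (s := Set.Ioi 0))
  have t2 := (c2.tendsto 0).mono_left (nhdsWithin_le_nhds (s := Set.Ioi 0))
  have := le_of_tendsto_of_tendsto t1 t2 (by
    filter_upwards [self_mem_nhdsWithin] with e he
    exact real_ineq_pos π ℓ hℓ hℓ1 t ht hn h (fun i => x i + e) v
      (fun i => add_pos_of_nonneg_of_pos (hx i) he))
  simpa using this

open Matrix ComplexOrder in
lemma quad_bound {n : ℕ} (A : Matrix (Fin n) (Fin n) ℂ) (hA : A.PosSemidef) (v : Fin n → ℂ) :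
    (star v ⬝ᵥ (A *ᵥ v)).re ≤ (∑ i, ‖v i‖ * Real.sqrt (A i i).re) ^ 2 := by
  have hentry : ∀ i j, ‖A i j‖ ≤ Real.sqrt (A i i).re * Real.sqrt (A j j).re := by
    intro i j
    have h := (hA.submatrix ![i, j]).det_nonneg
    rw [Matrix.det_fin_two] at h
    simp only [Matrix.submatrix_apply, Matrix.cons_val_zero, Matrix.cons_val_one] at h
    have hii := hA.diag_nonneg (i := i)
    have hjj := hA.diag_nonneg (i := j)
    have hji : A j i = star (A i j) := (hA.isHermitian.apply j i).symm
    rw [hji] at h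
    have h1 := (Complex.le_def.1 h).1
    have h2 := (Complex.le_def.1 hii)
    have h3 := (Complex.le_def.1 hjj)
    simp only [Complex.zero_re, Complex.zero_im] at h1 h2 h3
    rw [← Real.sqrt_mul h2.1]
    apply Real.le_sqrt_of_sq_le
    rw [← Complex.normSq_eq_norm_sq, Complex.normSq_apply]
    simp [← h2.2, ← h3.2] at h1
    linarith
  calc (star v ⬝ᵥ (A *ᵥ v)).re ≤ ‖star v ⬝ᵥ (A *ᵥ v)‖ := Complex.re_le_norm _
    _ = ‖∑ i, ∑ j, star (v i) * (A i j * v j)‖ := by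
      simp [dotProduct, mulVec, Finset.mul_sum]
    _ ≤ ∑ i, ∑ j, ‖star (v i) * (A i j * v j)‖ :=
      (norm_sum_le _ _).trans (Finset.sum_le_sum fun i _ => norm_sum_le _ _)
    _ ≤ ∑ i, ∑ j, (‖v i‖ * Real.sqrt (A i i).re) * (‖v j‖ * Real.sqrt (A j j).re) := by
      refine Finset.sum_le_sum fun i _ => Finset.sum_le_sum fun j _ => ?_
      rw [norm_mul, norm_mul, norm_star]
      have := mul_le_mul_of_nonneg_left (hentry i j) (mul_nonneg (norm_nonneg (v i)) (norm_nonneg (v j)))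
      linarith
    _ = _ := by rw [sq, Finset.sum_mul_sum]

open Matrix in
lemma diag_quad {n : ℕ} (f : Fin n → ℝ) (A : Matrix (Fin n) (Fin n) ℂ) (v : Fin n → ℂ) :
    star v ⬝ᵥ ((Matrix.diagonal (fun j => (f j : ℂ)) - A) *ᵥ v)
      = ((∑ j, f j * ‖v j‖ ^ 2 : ℝ) : ℂ) - star v ⬝ᵥ (A *ᵥ v) := by
  rw [sub_mulVec, dotProduct_sub]
  congr 1
  simp only [dotProduct, mulVec_diagonal]
  push_cast
  refine Finset.sum_congr rfl fun j _ => ?_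
  rw [← Complex.mul_conj']
  simp only [Pi.star_apply, RCLike.star_def]
  ring

lemma idx_aux {n : ℕ} (π : Equiv.Perm (Fin n)) (j₀ j : Fin n) (h : π.SameCycle j₀ j)
    (hj : π j ≠ j₀) :
    sInf {i : ℕ | (π ^ i) j₀ = π j} = sInf {i : ℕ | (π ^ i) j₀ = j} + 1 := by
  obtain ⟨i, -, hi⟩ := h.exists_pow_eq'
  have m1 := Nat.sInf_mem (s := {i : ℕ | (π ^ i) j₀ = j}) ⟨i, hi⟩
  have m1' : sInf {i : ℕ | (π ^ i) j₀ = j} + 1 ∈ {i : ℕ | (π ^ i) j₀ = π j} := by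
    have m1 : (π ^ sInf {i : ℕ | (π ^ i) j₀ = j}) j₀ = j := m1
    change (π ^ (_ + 1)) j₀ = π j
    rw [pow_succ', Equiv.Perm.mul_apply, m1]
  have m2 : (π ^ sInf {i : ℕ | (π ^ i) j₀ = π j}) j₀ = π j :=
    Nat.sInf_mem (s := {i : ℕ | (π ^ i) j₀ = π j}) ⟨_, m1'⟩
  apply le_antisymm (Nat.sInf_le m1')
  rcases hk : sInf {i : ℕ | (π ^ i) j₀ = π j} with _ | k
  · rw [hk] at m2
    exact absurd m2.symm hj
  · rw [hk, pow_succ', Equiv.Perm.mul_apply] at m2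
    have := Nat.sInf_le (s := {i : ℕ | (π ^ i) j₀ = j}) (π.injective m2)
    omega

lemma idx_off {n : ℕ} (π : Equiv.Perm (Fin n)) (j₀ j : Fin n) (h : ¬ π.SameCycle j₀ j) :
    sInf {i : ℕ | (π ^ i) j₀ = j} = 0 := by
  have : {i : ℕ | (π ^ i) j₀ = j} = ∅ := by
    ext i
    simp only [Set.mem_ofPred_eq, Set.mem_empty_iff_false, iff_false]
    intro hi
    exact h ⟨i, by simpa using hi⟩
  rw [this, Nat.sInf_empty]

lemma reverse_real {n : ℕ} (π : Equiv.Perm (Fin n)) (ℓ : ℕ)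
    (hℓ : (Equiv.Perm.cycleType π).sup = ℓ) (hℓ1 : 1 < ℓ) (t : ℝ) (ht : 0 ≤ t)
    (H : ∀ x v : Fin n → ℝ,
      (∑ i, v i * x i) ^ 2 ≤ ∑ i, ((n - t) * x i ^ 2 + t * x (π i) ^ 2) * v i ^ 2) :
    t * ℓ ≤ n := by
  classical
  obtain ⟨j₀, hj₀, hcard⟩ := perm_exists π ℓ hℓ hℓ1
  have hn : 0 < n := Fin.pos j₀
  have hn' : (0 : ℝ) < n := by exact_mod_cast hn
  have htn : 0 < n - t := by
    have := H (Pi.single j₀ 1) (Pi.single j₀ 1)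
    simp [Pi.single_apply, hj₀] at this
    linarith
  set C := Finset.univ.filter (fun y => π.SameCycle j₀ y) with hC
  set D := C.erase (π⁻¹ j₀) with hD
  have hmem : π⁻¹ j₀ ∈ C := by simp [hC, Equiv.Perm.SameCycle.refl]
  have hDcard : (D.card : ℝ) = ℓ - 1 := by
    rw [hD, Finset.card_erase_of_mem hmem, hcard, Nat.cast_sub hℓ1.le, Nat.cast_one]
  have hCc : ((Cᶜ).card : ℝ) = n - ℓ := by
    have := Finset.card_add_card_compl C
    rw [hcard, Fintype.card_fin] at this
    have : (ℓ : ℝ) + (Cᶜ).card = n := by exact_mod_cast this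
    linarith
  have main : ∀ e : ℝ, 0 < e → (n : ℝ) * (ℓ - 1) ≤ ℓ * (n - t + t * e ^ 2) := by
    intro e he
    set x : Fin n → ℝ := fun j => e ^ (sInf {i : ℕ | (π ^ i) j₀ = j}) with hx
    have hxpos : ∀ j, 0 < x j := fun j => pow_pos he _
    set f : Fin n → ℝ := fun i => (n - t) * x i ^ 2 + t * x (π i) ^ 2 with hf
    have hfpos : ∀ i, 0 < f i := fun i => by
      have := pow_pos (hxpos i) 2
      have := mul_pos htn this
      have : 0 ≤ t * x (π i) ^ 2 := by positivity
      simp only [hf]; linarith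
    set S := ∑ i, x i ^ 2 / f i with hS
    have hS1 : S ≤ 1 := by
      have h := H x (fun i => x i / f i)
      have e1 : ∑ i, x i / f i * x i = S :=
        Finset.sum_congr rfl fun i _ => by ring
      have e2 : ∑ i, ((n - t) * x i ^ 2 + t * x (π i) ^ 2) * (x i / f i) ^ 2 = S :=
        Finset.sum_congr rfl fun i _ => by
          change f i * _ = _
          have := hfpos i
          field_simp
      rw [e1, e2] at h
      nlinarith
    have hoff : ∀ i ∈ Cᶜ, x i ^ 2 / f i = 1 / n := by
      intro i hi
      have hi : ¬ π.SameCycle j₀ i := by simpa [hC] using hi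
      have hi2 : ¬ π.SameCycle j₀ (π i) := by simpa using hi
      simp only [hf, hx, idx_off π j₀ i hi, idx_off π j₀ _ hi2]
      simp
    have hon : ∀ i ∈ D, x i ^ 2 / f i = 1 / (n - t + t * e ^ 2) := by
      intro i hi
      rw [hD, Finset.mem_erase] at hi
      have hi2 : π.SameCycle j₀ i := by simpa [hC] using hi.2
      have hi1 : π i ≠ j₀ := fun h => hi.1 (by rw [← h]; simp)
      have hxi : x (π i) = x i * e := by
        simp only [hx, idx_aux π j₀ i hi2 hi1, pow_succ]
      have h1 := hxpos i
      have : f i = x i ^ 2 * (n - t + t * e ^ 2) := by simp only [hf, hxi]; ring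
      rw [this, div_mul_eq_div_div, div_self (by positivity)]
    have hpos : 0 < n - t + t * e ^ 2 := by positivity
    have hlow : (n - ℓ) * (1 / (n : ℝ)) + (ℓ - 1) * (1 / (n - t + t * e ^ 2)) ≤ S := by
      rw [hS, ← Finset.sum_compl_add_sum C, Finset.sum_congr rfl hoff, Finset.sum_const,
        nsmul_eq_mul, hCc]
      have : ∑ i ∈ D, x i ^ 2 / f i ≤ ∑ i ∈ C, x i ^ 2 / f i :=
        Finset.sum_le_sum_of_subset_of_nonneg (Finset.erase_subset _ _)
          (fun i _ _ => div_nonneg (sq_nonneg _) (hfpos i).le)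
      rw [Finset.sum_congr rfl hon, Finset.sum_const, nsmul_eq_mul, hDcard] at this
      linarith
    have h3 : (ℓ - 1) / (n - t + t * e ^ 2) ≤ ℓ / (n : ℝ) := by
      have e1 : (n - ℓ) * (1 / (n : ℝ)) = 1 - ℓ / n := by field_simp
      have e2 : ((ℓ : ℝ) - 1) * (1 / (n - t + t * e ^ 2)) = (ℓ - 1) / (n - t + t * e ^ 2) := by ring
      linarith
    rw [div_le_div_iff₀ hpos hn'] at h3
    linarith
  have c2 : Continuous fun e : ℝ => (ℓ : ℝ) * (n - t + t * e ^ 2) := by fun_prop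
  have t2 := (c2.tendsto 0).mono_left (nhdsWithin_le_nhds (s := Set.Ioi 0))
  have := ge_of_tendsto t2 (by
    filter_upwards [self_mem_nhdsWithin] with e he
    exact main e he)
  simp at this
  linarith

open Matrix ComplexOrder in
/-- for a permutation `π` with maximal cycle length `ℓ > 1`, the
`D`-type map with `D = (n−t)I + tP_π` is positive iff `t ≤ n/ℓ`. -/
theorem stmt_15 {n : ℕ} (π : Equiv.Perm (Fin n)) (ℓ : ℕ)
    (hℓ : (Equiv.Perm.cycleType π).sup = ℓ) (hℓ1 : 1 < ℓ)
    (t : ℝ) (ht : 0 ≤ t)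
    (Φ : Matrix (Fin n) (Fin n) ℂ → Matrix (Fin n) (Fin n) ℂ)
    (hΦ : ∀ A, Φ A = Matrix.diagonal (fun j => ∑ i,
        (((if i = j then (n : ℝ) - t else 0) +
          (if i = π j then t else 0) : ℝ) : ℂ) * A i i) - A) :
    (∀ A : Matrix (Fin n) (Fin n) ℂ, A.PosSemidef → (Φ A).PosSemidef)
    ↔ t ≤ (n : ℝ) / (ℓ : ℝ) := by
  have hl : (0 : ℝ) < ℓ := by exact_mod_cast (by omega : 0 < ℓ)
  rw [le_div_iff₀ hl]
  have hform : ∀ A : Matrix (Fin n) (Fin n) ℂ, A.PosSemidef → Φ A = Matrix.diagonal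
      (fun j => (((n - t) * (A j j).re + t * (A (π j) (π j)).re : ℝ) : ℂ)) - A := by
    intro A hA
    rw [hΦ A]
    congr 2
    ext1 j
    have hre : ∀ i, (((A i i).re : ℝ) : ℂ) = A i i := fun i => by
      have := (Complex.le_def.1 (hA.diag_nonneg (i := i))).2
      apply Complex.ext <;> simp
      simpa using this
    push_cast
    rw [hre, hre]
    simp [add_mul, Finset.sum_add_distrib, apply_ite (Complex.ofReal), ite_mul]
  constructor
  · intro H
    refine reverse_real π ℓ hℓ hℓ1 t ht fun x v => ?_
    have hA : (vecMulVec (fun i => (x i : ℂ)) (star fun i => (x i : ℂ))).PosSemidef :=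
      posSemidef_vecMulVec_self_star _
    have h := (H _ hA).dotProduct_mulVec_nonneg (fun i => (v i : ℂ))
    rw [hform _ hA, diag_quad] at h
    have h1 := (Complex.le_def.1 h).1
    have e : (star fun i => (v i : ℂ)) ⬝ᵥ
        (vecMulVec (fun i => (x i : ℂ)) (star fun i => (x i : ℂ)) *ᵥ fun i => (v i : ℂ))
        = (((∑ i, v i * x i) ^ 2 : ℝ) : ℂ) := by
      simp only [dotProduct, mulVec, vecMulVec_apply, Pi.star_apply, RCLike.star_def,
        Complex.conj_ofReal]
      push_cast
      rw [sq, Finset.sum_mul_sum]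
      refine Finset.sum_congr rfl fun i _ => ?_
      rw [Finset.mul_sum]
      refine Finset.sum_congr rfl fun j _ => ?_
      ring
    rw [e, Complex.sub_re, Complex.ofReal_re, Complex.ofReal_re, Complex.zero_re, sub_nonneg] at h1
    refine h1.trans (le_of_eq (Finset.sum_congr rfl fun i _ => ?_))
    simp [vecMulVec_apply]
    left
    ring
  · intro h A hA
    have hn : 0 < n := by
      obtain ⟨j₀, -⟩ := perm_exists π ℓ hℓ hℓ1
      exact Fin.pos j₀
    rw [hform A hA]
    have hherm : (Matrix.diagonal
      (fun j => (((n - t) * (A j j).re + t * (A (π j) (π j)).re : ℝ) : ℂ)) - A).IsHermitian := by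
      refine IsHermitian.sub (isHermitian_diagonal_of_self_adjoint _ ?_) hA.isHermitian
      ext j
      simp
    refine PosSemidef.of_dotProduct_mulVec_nonneg hherm fun v => ?_
    rw [diag_quad]
    have hq := Complex.le_def.1 (hA.dotProduct_mulVec_nonneg v)
    have hb := quad_bound A hA v
    have hr := real_ineq π ℓ hℓ hℓ1 t ht hn h (fun i => Real.sqrt (A i i).re) (fun i => ‖v i‖)
      (fun i => Real.sqrt_nonneg _)
    have hs : ∀ i, Real.sqrt (A i i).re ^ 2 = (A i i).re := fun i =>
      Real.sq_sqrt (Complex.le_def.1 (hA.diag_nonneg (i := i))).1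
    simp only [hs] at hr
    rw [Complex.le_def]
    constructor
    · rw [Complex.sub_re, Complex.ofReal_re, Complex.zero_re]
      linarith
    · rw [Complex.sub_im, Complex.ofReal_im, ← hq.2]
      simp
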